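/- Let n ≥ 1 and let A be an elasticity Z-tensor. Then: (i) A is a nonsingular elasticity M-tensor if and only if for every nonzero x ∈ ℝ^n with x ≥ 0 the symmetric Z-matrix A x² is a nonsingular M-matrix (equivalently, since A x² is a symmetric Z-matrix, positive definite); (ii) A is an elasticity M-tensor if and only if for every x ∈ ℝ^n with x ≥ 0 the symmetric Z-matrix A x² is an M-matrix (equivalently, positive semidefinite). -/

import Mathlib

open Finset

noncomputable section

/-- Symmetry condition of an elasticity tensor: `a_{ijkl} = a_{jikl} = a_{ijlk}`. -/
def ElastSym {n : ℕ} (A : Fin n → Fin n → Fin n → Fin n → ℝ) : Prop :=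
  ∀ i j k l, A i j k l = A j i k l ∧ A i j k l = A i j l k

/-- The scalar `A x² y² = ∑ a_{ijkl} x_i x_j y_k y_l`. -/
def tQuad {n : ℕ} (A : Fin n → Fin n → Fin n → Fin n → ℝ) (x y : Fin n → ℝ) : ℝ :=
  ∑ i, ∑ j, ∑ k, ∑ l, A i j k l * x i * x j * y k * y l

/-- The vector `(A x y²)_i = ∑ a_{ijkl} x_j y_k y_l`. -/
def tAxyy {n : ℕ} (A : Fin n → Fin n → Fin n → Fin n → ℝ) (x y : Fin n → ℝ) : Fin n → ℝ :=
  fun i => ∑ j, ∑ k, ∑ l, A i j k l * x j * y k * y l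

/-- The vector `(A x² y)_l = ∑ a_{ijkl} x_i x_j y_k`. -/
def tAxxy {n : ℕ} (A : Fin n → Fin n → Fin n → Fin n → ℝ) (x y : Fin n → ℝ) : Fin n → ℝ :=
  fun l => ∑ i, ∑ j, ∑ k, A i j k l * x i * x j * y k

/-- The matrix `(A x²)_{kl} = ∑ a_{ijkl} x_i x_j`. -/
def matAx2 {n : ℕ} (A : Fin n → Fin n → Fin n → Fin n → ℝ) (x : Fin n → ℝ) :
    Matrix (Fin n) (Fin n) ℝ :=
  Matrix.of fun k l => ∑ i, ∑ j, A i j k l * x i * x j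

/-- The matrix `(A y²)_{ij} = ∑ a_{ijkl} y_k y_l`. -/
def matAy2 {n : ℕ} (A : Fin n → Fin n → Fin n → Fin n → ℝ) (y : Fin n → ℝ) :
    Matrix (Fin n) (Fin n) ℝ :=
  Matrix.of fun i j => ∑ k, ∑ l, A i j k l * y k * y l

/-- The identity tensor `e_{ijkl} = 1` iff `i = j` and `k = l`. -/
def idT (n : ℕ) : Fin n → Fin n → Fin n → Fin n → ℝ :=
  fun i j k l => if i = j ∧ k = l then 1 else 0

/-- `xᵀ x = 1`. -/
def unitVec {n : ℕ} (x : Fin n → ℝ) : Prop := ∑ i, x i * x i = 1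

/-- `(λ, x, y)` is an M-eigenpair of `A`. -/
def IsMEig {n : ℕ} (A : Fin n → Fin n → Fin n → Fin n → ℝ) (lam : ℝ) (x y : Fin n → ℝ) :
    Prop :=
  (∀ i, tAxyy A x y i = lam * x i) ∧ (∀ l, tAxxy A x y l = lam * y l) ∧
    unitVec x ∧ unitVec y

/-- M-positive definiteness (the strong ellipticity condition). -/
def MPD {n : ℕ} (A : Fin n → Fin n → Fin n → Fin n → ℝ) : Prop :=
  ∀ x y : Fin n → ℝ, x ≠ 0 → y ≠ 0 → 0 < tQuad A x y

/-- M-positive semidefiniteness. -/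
def MPSD {n : ℕ} (A : Fin n → Fin n → Fin n → Fin n → ℝ) : Prop :=
  ∀ x y : Fin n → ℝ, 0 ≤ tQuad A x y

/-- All entries are nonnegative. -/
def NonnegT {n : ℕ} (A : Fin n → Fin n → Fin n → Fin n → ℝ) : Prop :=
  ∀ i j k l, 0 ≤ A i j k l

/-- The M-spectral radius of a nonnegative elasticity tensor:
`sup { B x² y² : xᵀx = yᵀy = 1 }`. -/
def rhoM {n : ℕ} (B : Fin n → Fin n → Fin n → Fin n → ℝ) : ℝ :=
  sSup { r : ℝ | ∃ x y : Fin n → ℝ, unitVec x ∧ unitVec y ∧ r = tQuad B x y }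

/-- An elasticity Z-tensor: all off-diagonal entries nonpositive. -/
def ZTensor {n : ℕ} (A : Fin n → Fin n → Fin n → Fin n → ℝ) : Prop :=
  ∀ i j k l, ¬(i = j ∧ k = l) → A i j k l ≤ 0

/-- A nonsingular elasticity M-tensor: `A = s E - B` with `B` nonnegative and `s > ρ_M(B)`. -/
def NonsingMT {n : ℕ} (A : Fin n → Fin n → Fin n → Fin n → ℝ) : Prop :=
  ∃ (s : ℝ) (B : Fin n → Fin n → Fin n → Fin n → ℝ),
    ElastSym B ∧ NonnegT B ∧ (∀ i j k l, A i j k l = s * idT n i j k l - B i j k l) ∧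
      rhoM B < s

/-- An elasticity M-tensor: `A = s E - B` with `B` nonnegative and `s ≥ ρ_M(B)`. -/
def ElastMT {n : ℕ} (A : Fin n → Fin n → Fin n → Fin n → ℝ) : Prop :=
  ∃ (s : ℝ) (B : Fin n → Fin n → Fin n → Fin n → ℝ),
    ElastSym B ∧ NonnegT B ∧ (∀ i j k l, A i j k l = s * idT n i j k l - B i j k l) ∧
      rhoM B ≤ s

/-- Irreducibility of a (nonnegative) square matrix. -/
def MatIrred {n : ℕ} (M : Matrix (Fin n) (Fin n) ℝ) : Prop :=
  ∀ S : Finset (Fin n), S.Nonempty → S ≠ Finset.univ → ∃ k ∈ S, ∃ l ∉ S, M k l ≠ 0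

/-- Strict diagonal dominance. -/
def SDD {n : ℕ} (M : Matrix (Fin n) (Fin n) ℝ) : Prop :=
  ∀ i, ∑ j ∈ Finset.univ.erase i, |M i j| < |M i i|

/-- `A x² y²` is the quadratic form of the matrix `A x²` at `y`. -/
lemma dotProduct_matAx2_mulVec {n : ℕ} (A : Fin n → Fin n → Fin n → Fin n → ℝ)
    (x y : Fin n → ℝ) : star y ⬝ᵥ (matAx2 A x).mulVec y = tQuad A x y := by
  simp only [dotProduct, Matrix.mulVec, matAx2, Matrix.of_apply, tQuad, star_trivial,
    Finset.mul_sum, Finset.sum_mul]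
  calc _ = ∑ k, ∑ i, ∑ l, ∑ j, y k * (A i j k l * x i * x j * y l) :=
        Finset.sum_congr rfl fun k _ => Finset.sum_comm
    _ = ∑ i, ∑ k, ∑ j, ∑ l, y k * (A i j k l * x i * x j * y l) := by
        rw [Finset.sum_comm]
        exact Finset.sum_congr rfl fun i _ => Finset.sum_congr rfl fun k _ => Finset.sum_comm
    _ = ∑ i, ∑ j, ∑ k, ∑ l, y k * (A i j k l * x i * x j * y l) :=
        Finset.sum_congr rfl fun i _ => Finset.sum_comm
    _ = _ := by
        refine Finset.sum_congr rfl fun i _ => Finset.sum_congr rfl fun j _ =>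
          Finset.sum_congr rfl fun k _ => Finset.sum_congr rfl fun l _ => ?_
        ring

lemma ElastSym.isHermitian_matAx2 {n : ℕ} {A : Fin n → Fin n → Fin n → Fin n → ℝ}
    (hA : ElastSym A) (x : Fin n → ℝ) : (matAx2 A x).IsHermitian := by
  ext k l
  simp only [Matrix.conjTranspose_apply, matAx2, Matrix.of_apply, star_trivial]
  exact Finset.sum_congr rfl fun i _ => Finset.sum_congr rfl fun j _ => by
    rw [(hA i j l k).2]

lemma tQuad_smul {n : ℕ} (A : Fin n → Fin n → Fin n → Fin n → ℝ) (c d : ℝ)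
    (x y : Fin n → ℝ) : tQuad A (c • x) (d • y) = c ^ 2 * d ^ 2 * tQuad A x y := by
  simp only [tQuad, Finset.mul_sum, Pi.smul_apply, smul_eq_mul]
  refine Finset.sum_congr rfl fun i _ => Finset.sum_congr rfl fun j _ =>
    Finset.sum_congr rfl fun k _ => Finset.sum_congr rfl fun l _ => ?_
  ring

lemma tQuad_idT {n : ℕ} (x y : Fin n → ℝ) :
    tQuad (idT n) x y = (∑ i, x i * x i) * ∑ k, y k * y k := by
  simp only [tQuad, idT, ite_mul, one_mul, zero_mul, ite_and, Finset.sum_mul_sum]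
  refine Finset.sum_congr rfl fun i _ => ?_
  rw [Finset.sum_eq_single i (fun j _ hj => by simp [hj.symm]) (by simp)]
  simp [mul_assoc]

/-- Evaluation of the quadratic form of `s E - B`. -/
lemma tQuad_of_eq_sub {n : ℕ} {A B : Fin n → Fin n → Fin n → Fin n → ℝ} {s : ℝ}
    (h : ∀ i j k l, A i j k l = s * idT n i j k l - B i j k l) (x y : Fin n → ℝ) :
    tQuad A x y = s * ((∑ i, x i * x i) * ∑ k, y k * y k) - tQuad B x y := by
  rw [← tQuad_idT]
  simp only [tQuad, Finset.mul_sum, ← Finset.sum_sub_distrib]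
  refine Finset.sum_congr rfl fun i _ => Finset.sum_congr rfl fun j _ =>
    Finset.sum_congr rfl fun k _ => Finset.sum_congr rfl fun l _ => ?_
  rw [h]
  ring

lemma continuous_tQuad {n : ℕ} (A : Fin n → Fin n → Fin n → Fin n → ℝ) :
    Continuous fun p : (Fin n → ℝ) × (Fin n → ℝ) => tQuad A p.1 p.2 := by
  unfold tQuad
  fun_prop

lemma isCompact_unitVec (n : ℕ) : IsCompact {x : Fin n → ℝ | unitVec x} := by
  refine (isCompact_Icc (a := (-1 : Fin n → ℝ)) (b := 1)).of_isClosed_subset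
    (isClosed_eq (by fun_prop) continuous_const) fun x hx => ?_
  have h (i : Fin n) : x i ^ 2 ≤ 1 := by
    have hi := Finset.single_le_sum (f := fun i => x i * x i)
      (fun i _ => mul_self_nonneg (x i)) (Finset.mem_univ i)
    rw [show ∑ i, x i * x i = 1 from hx] at hi
    simpa [sq] using hi
  have h' (i : Fin n) := abs_le.mp ((sq_le_one_iff_abs_le_one _).mp (h i))
  exact ⟨fun i => (h' i).1, fun i => (h' i).2⟩

/-- The supremum defining the M-spectral radius is attained. -/
lemma exists_isGreatest_tQuad {n : ℕ} (hn : 1 ≤ n)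
    (B : Fin n → Fin n → Fin n → Fin n → ℝ) :
    ∃ x y : Fin n → ℝ, unitVec x ∧ unitVec y ∧
      IsGreatest {r : ℝ | ∃ x y : Fin n → ℝ, unitVec x ∧ unitVec y ∧ r = tQuad B x y}
        (tQuad B x y) := by
  have he : unitVec (Pi.single (⟨0, hn⟩ : Fin n) (1 : ℝ)) := by
    simp [unitVec, Pi.single_apply]
  obtain ⟨⟨u, v⟩, hp, hmax⟩ :=
    ((isCompact_unitVec n).prod (isCompact_unitVec n)).exists_isMaxOn
      ⟨(_, _), Set.mk_mem_prod he he⟩ (continuous_tQuad B).continuousOn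
  obtain ⟨hu, hv⟩ := Set.mem_prod.mp hp
  refine ⟨u, v, hu, hv, ⟨u, v, hu, hv, rfl⟩, ?_⟩
  rintro _ ⟨x, y, hx, hy, rfl⟩
  exact isMaxOn_iff.mp hmax (x, y) (Set.mk_mem_prod hx hy)

lemma tQuad_le_rhoM {n : ℕ} (hn : 1 ≤ n) (B : Fin n → Fin n → Fin n → Fin n → ℝ)
    {x y : Fin n → ℝ} (hx : unitVec x) (hy : unitVec y) : tQuad B x y ≤ rhoM B := by
  obtain ⟨_, _, -, -, h⟩ := exists_isGreatest_tQuad hn B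
  exact le_csSup ⟨_, h.2⟩ ⟨x, y, hx, hy, rfl⟩

lemma exists_rhoM_eq {n : ℕ} (hn : 1 ≤ n) (B : Fin n → Fin n → Fin n → Fin n → ℝ) :
    ∃ x y : Fin n → ℝ, unitVec x ∧ unitVec y ∧ rhoM B = tQuad B x y := by
  obtain ⟨x, y, hx, hy, h⟩ := exists_isGreatest_tQuad hn B
  exact ⟨x, y, hx, hy, h.csSup_eq⟩

lemma unitVec.ne_zero {n : ℕ} {x : Fin n → ℝ} (hx : unitVec x) : x ≠ 0 := by
  rintro rfl
  simp [unitVec] at hx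

lemma unitVec.abs {n : ℕ} {x : Fin n → ℝ} (hx : unitVec x) : unitVec |x| := by
  simpa [unitVec] using hx

/-- A nonzero vector is a nonzero multiple of a unit vector. -/
lemma exists_unitVec_smul {n : ℕ} {x : Fin n → ℝ} (hx : x ≠ 0) :
    ∃ c : ℝ, c ≠ 0 ∧ ∃ u, unitVec u ∧ x = c • u := by
  have hnonneg : 0 ≤ ∑ i, x i * x i := Finset.sum_nonneg fun i _ => mul_self_nonneg _
  have hne : ∑ i, x i * x i ≠ 0 := fun h => hx <| funext fun i =>
    mul_self_eq_zero.mp <| (Finset.sum_eq_zero_iff_of_nonneg fun i _ => mul_self_nonneg (x i)).mp h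
      i (Finset.mem_univ i)
  have hc : √(∑ i, x i * x i) ≠ 0 := (Real.sqrt_ne_zero hnonneg).mpr hne
  refine ⟨√(∑ i, x i * x i), hc, (√(∑ i, x i * x i))⁻¹ • x, ?_, (smul_inv_smul₀ hc x).symm⟩
  simp only [unitVec, Pi.smul_apply, smul_eq_mul]
  simp_rw [fun i => mul_mul_mul_comm (√(∑ i, x i * x i))⁻¹ (x i) (√(∑ i, x i * x i))⁻¹ (x i)]
  rw [← Finset.mul_sum, ← mul_inv, Real.mul_self_sqrt hnonneg, inv_mul_cancel₀ hne]

lemma MPD_of_unitVec {n : ℕ} {A : Fin n → Fin n → Fin n → Fin n → ℝ}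
    (h : ∀ x y, unitVec x → unitVec y → 0 < tQuad A x y) : MPD A := by
  intro x y hx hy
  obtain ⟨c, hc, u, hu, rfl⟩ := exists_unitVec_smul hx
  obtain ⟨d, hd, v, hv, rfl⟩ := exists_unitVec_smul hy
  rw [tQuad_smul]
  have := h u v hu hv
  positivity

lemma MPSD_of_unitVec {n : ℕ} {A : Fin n → Fin n → Fin n → Fin n → ℝ}
    (h : ∀ x y, unitVec x → unitVec y → 0 ≤ tQuad A x y) : MPSD A := by
  intro x y
  by_cases hx : x = 0
  · simp [hx, tQuad]
  by_cases hy : y = 0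
  · simp [hy, tQuad]
  obtain ⟨c, -, u, hu, rfl⟩ := exists_unitVec_smul hx
  obtain ⟨d, -, v, hv, rfl⟩ := exists_unitVec_smul hy
  rw [tQuad_smul]
  have := h u v hu hv
  positivity

lemma tQuad_eq_sub_of_unitVec {n : ℕ} {A B : Fin n → Fin n → Fin n → Fin n → ℝ} {s : ℝ}
    (h : ∀ i j k l, A i j k l = s * idT n i j k l - B i j k l) {x y : Fin n → ℝ}
    (hx : unitVec x) (hy : unitVec y) : tQuad A x y = s - tQuad B x y := by
  rw [tQuad_of_eq_sub h, show ∑ i, x i * x i = 1 from hx, show ∑ i, y i * y i = 1 from hy]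
  ring

lemma NonsingMT.MPD {n : ℕ} (hn : 1 ≤ n) {A : Fin n → Fin n → Fin n → Fin n → ℝ}
    (hA : NonsingMT A) : MPD A := by
  obtain ⟨s, B, -, -, hAB, hs⟩ := hA
  refine MPD_of_unitVec fun x y hx hy => ?_
  rw [tQuad_eq_sub_of_unitVec hAB hx hy, sub_pos]
  exact (tQuad_le_rhoM hn B hx hy).trans_lt hs

lemma ElastMT.MPSD {n : ℕ} (hn : 1 ≤ n) {A : Fin n → Fin n → Fin n → Fin n → ℝ}
    (hA : ElastMT A) : MPSD A := by
  obtain ⟨s, B, -, -, hAB, hs⟩ := hA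
  refine MPSD_of_unitVec fun x y hx hy => ?_
  rw [tQuad_eq_sub_of_unitVec hAB hx hy, sub_nonneg]
  exact (tQuad_le_rhoM hn B hx hy).trans hs

/-- An elasticity Z-tensor has the form `s E - B` with `B` nonnegative. -/
lemma ZTensor.exists_eq_sub {n : ℕ} {A : Fin n → Fin n → Fin n → Fin n → ℝ}
    (hA : ElastSym A) (hZ : ZTensor A) :
    ∃ (s : ℝ) (B : Fin n → Fin n → Fin n → Fin n → ℝ), ElastSym B ∧ NonnegT B ∧
      ∀ i j k l, A i j k l = s * idT n i j k l - B i j k l := by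
  refine ⟨∑ i, ∑ k, |A i i k k|, fun i j k l => (∑ i, ∑ k, |A i i k k|) * idT n i j k l - A i j k l,
    fun i j k l => ?_, fun i j k l => ?_, fun i j k l => by ring⟩
  · simp only [idT, eq_comm (a := j) (b := i), eq_comm (a := l) (b := k), ← (hA i j k l).1,
      ← (hA i j k l).2, and_self]
  · by_cases h : i = j ∧ k = l
    · obtain ⟨rfl, rfl⟩ := h
      have h₁ := Finset.single_le_sum (f := fun k => |A i i k k|)
        (fun k _ => abs_nonneg _) (Finset.mem_univ k)
      have h₂ := Finset.single_le_sum (f := fun i => ∑ k, |A i i k k|)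
        (fun i _ => Finset.sum_nonneg fun k _ => abs_nonneg _) (Finset.mem_univ i)
      simpa [idT] using (le_abs_self _).trans (h₁.trans h₂)
    · simpa [idT, h] using hZ i j k l h

lemma NonnegT.tQuad_le_tQuad_abs {n : ℕ} {B : Fin n → Fin n → Fin n → Fin n → ℝ}
    (hB : NonnegT B) (x y : Fin n → ℝ) : tQuad B x y ≤ tQuad B |x| |y| := by
  refine Finset.sum_le_sum fun i _ => Finset.sum_le_sum fun j _ =>
    Finset.sum_le_sum fun k _ => Finset.sum_le_sum fun l _ => ?_
  refine (le_abs_self _).trans_eq ?_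
  simp [abs_mul, abs_of_nonneg (hB i j k l)]

/-- The M-spectral radius of a nonnegative tensor is attained at nonnegative unit vectors. -/
lemma NonnegT.exists_nonneg_rhoM_eq {n : ℕ} (hn : 1 ≤ n)
    {B : Fin n → Fin n → Fin n → Fin n → ℝ} (hB : NonnegT B) :
    ∃ x y : Fin n → ℝ, unitVec x ∧ unitVec y ∧ (∀ i, 0 ≤ x i) ∧ rhoM B = tQuad B x y := by
  obtain ⟨x, y, hx, hy, h⟩ := exists_rhoM_eq hn B
  exact ⟨|x|, |y|, hx.abs, hy.abs, fun i => abs_nonneg (x i),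
    (h.trans_le (hB.tQuad_le_tQuad_abs x y)).antisymm (tQuad_le_rhoM hn B hx.abs hy.abs)⟩

/-- an elasticity Z-tensor is a nonsingular elasticity M-tensor iff
`A x²` is positive definite (a nonsingular M-matrix) for every nonzero `x ≥ 0`, and an
elasticity M-tensor iff `A x²` is positive semidefinite (an M-matrix) for every `x ≥ 0`. -/
theorem stmt_16 {n : ℕ} (hn : 1 ≤ n) (A : Fin n → Fin n → Fin n → Fin n → ℝ)
    (hA : ElastSym A) (hZ : ZTensor A) :
    (NonsingMT A ↔ ∀ x : Fin n → ℝ, x ≠ 0 → (∀ i, 0 ≤ x i) → (matAx2 A x).PosDef) ∧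
    (ElastMT A ↔ ∀ x : Fin n → ℝ, (∀ i, 0 ≤ x i) → (matAx2 A x).PosSemidef) := by
  obtain ⟨s, B, hB, hB0, hAB⟩ := ZTensor.exists_eq_sub hA hZ
  obtain ⟨u, v, hu, hv, hu0, hρ⟩ := hB0.exists_nonneg_rhoM_eq hn
  have huv := tQuad_eq_sub_of_unitVec hAB hu hv
  refine ⟨⟨fun h x hx _ => ?_, fun h => ⟨s, B, hB, hB0, hAB, ?_⟩⟩,
    ⟨fun h x _ => ?_, fun h => ⟨s, B, hB, hB0, hAB, ?_⟩⟩⟩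
  · refine .of_dotProduct_mulVec_pos (hA.isHermitian_matAx2 x) fun y hy => ?_
    rw [dotProduct_matAx2_mulVec]
    exact h.MPD hn x y hx hy
  · have := (h u hu.ne_zero hu0).dotProduct_mulVec_pos hv.ne_zero
    rw [dotProduct_matAx2_mulVec] at this
    linarith
  · refine .of_dotProduct_mulVec_nonneg (hA.isHermitian_matAx2 x) fun y => ?_
    rw [dotProduct_matAx2_mulVec]
    exact h.MPSD hn x y
  · have := (h u hu0).dotProduct_mulVec_nonneg v
    rw [dotProduct_matAx2_mulVec] at this
    linarith
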